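/- Let f be a meromorphic function on ℂ that is the ratio of two linearly independent solutions of ψ'' = Pψ with P a polynomial. Then f omits at most finitely many values only among its asymptotic values; in particular, every value w ∈ ℂ∪{∞} that is not one of the asymptotic values w_0,…,w_4 is attained by f infinitely often. As a corollary, f has infinitely many poles whenever ∞ is not an asymptotic value of f. -/

import Mathlib

open OnePoint Filter Topology

/-- The ratio φ/χ as a map to the Riemann sphere ℂ ∪ {∞}. -/
noncomputable def ratioToSphere (φ χ : ℂ → ℂ) (lam : ℂ) : OnePoint ℂ :=
  if χ lam = 0 then ∞ else ((φ lam / χ lam : ℂ) : OnePoint ℂ)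

section LinearODE

open Polynomial Set

/-- Grönwall bound for entire solutions of `ψ'' = p ψ`. -/
lemma norm_le_of_deriv_deriv_eq_mul {ψ p : ℂ → ℂ} (hψ : Differentiable ℂ ψ)
    (hψ' : Differentiable ℂ (deriv ψ)) (hode : ∀ z, deriv (deriv ψ) z = p z * ψ z)
    {a z : ℂ} {K : ℝ} (hK : 1 ≤ K) (hp : ∀ y ∈ Metric.closedBall a ‖z - a‖, ‖p y‖ ≤ K) :
    ‖ψ z‖ ≤ max ‖ψ a‖ ‖deriv ψ a‖ * Real.exp (K * ‖z - a‖) := by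
  let γ : ℝ → ℂ := fun t => a + t * (z - a)
  have hγ (t : ℝ) : HasDerivAt γ (z - a) t := by
    simpa [γ] using ((Complex.ofRealCLM.hasDerivAt (x := t)).mul_const (z - a)).const_add a
  let F : ℝ → ℂ × ℂ := fun t => (ψ (γ t), deriv ψ (γ t))
  have hF (t : ℝ) :
      HasDerivAt F (deriv ψ (γ t) * (z - a), p (γ t) * ψ (γ t) * (z - a)) t := by
    refine ((hψ (γ t)).hasDerivAt.comp t (hγ t)).prodMk ?_
    rw [← hode]
    exact (hψ' (γ t)).hasDerivAt.comp t (hγ t)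
  have key := norm_le_gronwallBound_of_norm_deriv_right_le (f := F) (a := 0) (b := 1)
    (δ := max ‖ψ a‖ ‖deriv ψ a‖) (K := K * ‖z - a‖) (ε := 0)
    (fun t _ => (hF t).continuousAt.continuousWithinAt)
    (fun t _ => (hF t).hasDerivWithinAt) (by simp [F, γ, Prod.norm_def]) ?_ 1 (by simp)
  · rw [gronwallBound_ε0] at key
    have h1 : ‖ψ z‖ ≤ ‖F 1‖ := by
      simp [F, γ]
    simpa using h1.trans key
  · intro t ht
    have hpt : ‖p (γ t)‖ ≤ K := by
      apply hp
      rw [mem_closedBall_iff_norm]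
      simp only [γ, add_sub_cancel_left, norm_mul, Complex.norm_real, Real.norm_eq_abs,
        abs_of_nonneg ht.1]
      exact mul_le_of_le_one_left (norm_nonneg _) ht.2.le
    rw [add_zero, Prod.norm_def, max_le_iff]
    have h1 : ‖ψ (γ t)‖ ≤ ‖F t‖ := norm_fst_le (F t)
    have h2 : ‖deriv ψ (γ t)‖ ≤ ‖F t‖ := norm_snd_le (F t)
    have h0 := norm_nonneg (z - a)
    have hF0 := norm_nonneg (F t)
    constructor
    · calc ‖deriv ψ (γ t) * (z - a)‖ = 1 * ‖z - a‖ * ‖deriv ψ (γ t)‖ := by rw [norm_mul]; ring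
        _ ≤ K * ‖z - a‖ * ‖F t‖ := by gcongr
    · calc ‖p (γ t) * ψ (γ t) * (z - a)‖ = ‖p (γ t)‖ * ‖z - a‖ * ‖ψ (γ t)‖ := by
            rw [norm_mul, norm_mul]; ring
        _ ≤ K * ‖z - a‖ * ‖F t‖ := by gcongr

/-- A solution of `ψ'' = p ψ` with vanishing Cauchy data is zero. -/
lemma eq_zero_of_deriv_deriv_eq_mul {ψ p : ℂ → ℂ} (hψ : Differentiable ℂ ψ)
    (hψ' : Differentiable ℂ (deriv ψ)) (hp : Continuous p)
    (hode : ∀ z, deriv (deriv ψ) z = p z * ψ z) {a : ℂ} (h0 : ψ a = 0) (h1 : deriv ψ a = 0)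
    (z : ℂ) : ψ z = 0 := by
  obtain ⟨K, hK⟩ := (isCompact_closedBall a ‖z - a‖).exists_bound_of_continuousOn hp.continuousOn
  simpa [h0, h1] using norm_le_of_deriv_deriv_eq_mul hψ hψ' hode (le_max_left 1 K)
    fun y hy => (hK y hy).trans (le_max_right 1 K)

lemma Polynomial.exists_norm_eval_le (P : ℂ[X]) :
    ∃ C : ℝ, 1 ≤ C ∧ ∀ z, ‖P.eval z‖ ≤ C * (1 + ‖z‖) ^ P.natDegree := by
  refine ⟨1 + ∑ i ∈ Finset.range (P.natDegree + 1), ‖P.coeff i‖,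
    le_add_of_nonneg_right (by positivity), fun z => ?_⟩
  rw [eval_eq_sum_range]
  calc _ ≤ ∑ i ∈ Finset.range (P.natDegree + 1), ‖P.coeff i * z ^ i‖ := norm_sum_le _ _
    _ ≤ ∑ i ∈ Finset.range (P.natDegree + 1), ‖P.coeff i‖ * (1 + ‖z‖) ^ P.natDegree := by
      refine Finset.sum_le_sum fun i hi => ?_
      rw [norm_mul, norm_pow]
      gcongr
      calc ‖z‖ ^ i ≤ (1 + ‖z‖) ^ i := by gcongr; linarith
        _ ≤ _ := by
          apply pow_le_pow_right₀
          · linarith [norm_nonneg z]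
          · exact Nat.lt_succ_iff.mp (Finset.mem_range.mp hi)
    _ ≤ _ := by
      rw [← Finset.sum_mul]
      gcongr
      linarith

/-- `f` is of finite order at most `m`, in a form convenient for estimates. -/
def HasExpPowGrowth (m : ℕ) (f : ℂ → ℂ) : Prop :=
  ∃ C : ℝ, ∀ z, ‖f z‖ ≤ Real.exp (C * (1 + ‖z‖) ^ m)

lemma hasExpPowGrowth_of_deriv_deriv_eq_mul {ψ : ℂ → ℂ} {P : ℂ[X]} (hψ : Differentiable ℂ ψ)
    (hψ' : Differentiable ℂ (deriv ψ)) (hode : ∀ z, deriv (deriv ψ) z = P.eval z * ψ z) :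
    HasExpPowGrowth (P.natDegree + 1) ψ := by
  obtain ⟨C, hC1, hC⟩ := P.exists_norm_eval_le
  set A := max ‖ψ 0‖ ‖deriv ψ 0‖
  have hA : 0 ≤ A := (norm_nonneg _).trans (le_max_left _ _)
  refine ⟨A + C, fun z => ?_⟩
  have hz1 : 1 ≤ 1 + ‖z‖ := by linarith [norm_nonneg z]
  have h := norm_le_of_deriv_deriv_eq_mul hψ hψ' hode (a := 0) (z := z)
    (K := C * (1 + ‖z‖) ^ P.natDegree) (one_le_mul_of_one_le_of_one_le hC1 (one_le_pow₀ hz1)) ?_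
  · refine h.trans ?_
    calc A * Real.exp (C * (1 + ‖z‖) ^ P.natDegree * ‖z - 0‖)
        ≤ Real.exp A * Real.exp (C * (1 + ‖z‖) ^ P.natDegree * (1 + ‖z‖)) := by
          gcongr
          · linarith [Real.add_one_le_exp A]
          · simp
      _ = Real.exp (A * 1 + C * (1 + ‖z‖) ^ (P.natDegree + 1)) := by
          rw [← Real.exp_add]; ring_nf
      _ ≤ Real.exp ((A + C) * (1 + ‖z‖) ^ (P.natDegree + 1)) := by
          rw [add_mul]
          gcongr
          exact one_le_pow₀ hz1
  · intro y hy
    have : ‖y‖ ≤ ‖z‖ := by simpa using hy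
    exact (hC y).trans (by gcongr)

lemma HasExpPowGrowth.dslope {m : ℕ} {f : ℂ → ℂ} (hf : HasExpPowGrowth m f) {a : ℂ}
    (hd : Continuous (dslope f a)) (ha : f a = 0) : HasExpPowGrowth m (dslope f a) := by
  obtain ⟨C, hC⟩ := hf
  obtain ⟨M, hM⟩ := (isCompact_closedBall a 1).exists_bound_of_continuousOn hd.continuousOn
  refine ⟨max C (max M 0), fun z => ?_⟩
  have hz1 : 1 ≤ (1 + ‖z‖) ^ m := one_le_pow₀ (by linarith [norm_nonneg z])
  rcases le_total ‖z - a‖ 1 with h | h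
  · calc ‖_root_.dslope f a z‖ ≤ max M 0 * 1 := by
          simpa using Or.inl (hM z (by simpa [dist_eq_norm] using h))
      _ ≤ max C (max M 0) * (1 + ‖z‖) ^ m := by
          exact mul_le_mul (le_max_right _ _) hz1 zero_le_one
            ((le_max_right M 0).trans (le_max_right _ _))
      _ ≤ _ := by linarith [Real.add_one_le_exp (max C (max M 0) * (1 + ‖z‖) ^ m)]
  · have hmul : (z - a) * _root_.dslope f a z = f z := by
      simpa [ha] using sub_smul_dslope f a z
    calc ‖_root_.dslope f a z‖ ≤ ‖z - a‖ * ‖_root_.dslope f a z‖ :=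
          le_mul_of_one_le_left (norm_nonneg _) h
      _ = ‖f z‖ := by rw [← norm_mul, hmul]
      _ ≤ Real.exp (C * (1 + ‖z‖) ^ m) := hC z
      _ ≤ _ := by
          gcongr
          exact le_max_left _ _

lemma Differentiable.dslope {f : ℂ → ℂ} (hf : Differentiable ℂ f) (a : ℂ) :
    Differentiable ℂ (dslope f a) :=
  differentiableOn_univ.mp
    ((Complex.differentiableOn_dslope Filter.univ_mem).mpr hf.differentiableOn)

/-- Division of an entire function by its finitely many simple zeros. -/
lemma exists_eq_polynomial_mul_of_finite_zeros {m : ℕ} {s : Set ℂ} (hs : s.Finite) :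
    ∀ {f : ℂ → ℂ}, Differentiable ℂ f → HasExpPowGrowth m f → {z | f z = 0} = s →
      (∀ z, f z = 0 → deriv f z ≠ 0) →
      ∃ (Q : ℂ[X]) (h : ℂ → ℂ), Differentiable ℂ h ∧ HasExpPowGrowth m h ∧ (∀ z, h z ≠ 0) ∧
        ∀ z, f z = Q.eval z * h z := by
  induction s, hs using Set.Finite.induction_on with
  | empty =>
    intro f hf hg hs _
    exact ⟨1, f, hf, hg, fun z hz => (hs.subset hz : z ∈ (∅ : Set ℂ)), by simp⟩
  | @insert a s has _ ih =>
    intro f hf hg hs hsimple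
    have hfa : f a = 0 := hs.superset (mem_insert a s)
    have hd := hf.dslope a
    have hmul (z : ℂ) : f z = (z - a) * dslope f a z := by
      simpa [hfa] using (sub_smul_dslope f a z).symm
    have hda : dslope f a a ≠ 0 := by simpa using hsimple a hfa
    have hzeros : {z | dslope f a z = 0} = s := by
      ext z
      constructor
      · intro hz
        have : z ∈ insert a s := hs.subset (by simp [hmul z, show dslope f a z = 0 from hz])
        exact this.resolve_left fun h => hda (h ▸ hz)
      · intro hz
        have hfz : f z = 0 := hs.superset (mem_insert_of_mem a hz)
        rw [hmul] at hfz
        exact (mul_eq_zero.mp hfz).resolve_left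
          (sub_ne_zero.mpr fun h => has (h ▸ hz))
    have hsimple_dslope (z : ℂ) (hz : dslope f a z = 0) : deriv (dslope f a) z ≠ 0 := by
      intro hz'
      apply hsimple z (by simp [hmul z, hz])
      have : HasDerivAt f (1 * dslope f a z + (z - a) * deriv (dslope f a) z) z := by
        exact (((hasDerivAt_id z).sub_const a).mul (hd z).hasDerivAt).congr_of_eventuallyEq
          (.of_forall hmul)
      simpa [hz, hz'] using this.deriv
    obtain ⟨Q, h, hh, hhg, hh0, hQ⟩ :=
      ih hd (hg.dslope hd.continuous hfa) hzeros hsimple_dslope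
    refine ⟨(X - C a) * Q, h, hh, hhg, hh0, fun z => ?_⟩
    rw [hmul, hQ]
    simp [mul_assoc]

/-- An entire function of polynomial growth is a polynomial. -/
lemma Differentiable.exists_polynomial_of_norm_le {g : ℂ → ℂ} (hg : Differentiable ℂ g) {m : ℕ}
    {A : ℝ} (hA : ∀ z, ‖g z‖ ≤ A * (1 + ‖z‖) ^ m) : ∃ G : ℂ[X], ∀ z, g z = G.eval z := by
  have hzero (k : ℕ) (hk : m < k) : iteratedDeriv k g 0 = 0 := by
    have hbound : ∀ᶠ R : ℝ in atTop,
        ‖iteratedDeriv k g 0‖ ≤ (k.factorial * (A * 2 ^ m)) * (R ^ (k - m))⁻¹ := by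
      filter_upwards [eventually_ge_atTop 1] with R hR
      have hR0 : 0 < R := by linarith
      have hA0 : 0 ≤ A := by simpa using (norm_nonneg _).trans (hA 0)
      refine (Complex.norm_iteratedDeriv_le_of_forall_mem_sphere_norm_le k hR0
        hg.diffContOnCl (C := A * (2 * R) ^ m) fun z hz => ?_).trans_eq ?_
      · have hzR : ‖z‖ = R := by simpa using hz
        refine (hA z).trans ?_
        gcongr
        linarith
      · obtain ⟨j, rfl⟩ := Nat.exists_eq_add_of_lt hk
        rw [show m + j + 1 - m = j + 1 by omega]
        field_simp
        ring
    have hlim : Tendsto (fun R : ℝ => (k.factorial * (A * 2 ^ m)) * (R ^ (k - m))⁻¹) atTop (𝓝 0) := by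
      simpa using (tendsto_pow_atTop (α := ℝ) (n := k - m)
        (by omega)).inv_tendsto_atTop.const_mul (k.factorial * (A * 2 ^ m))
    exact norm_le_zero_iff.mp (ge_of_tendsto hlim hbound)
  refine ⟨∑ k ∈ Finset.range (m + 1), C ((k.factorial : ℂ)⁻¹ * iteratedDeriv k g 0) * X ^ k,
    fun z => ?_⟩
  rw [← Complex.taylorSeries_eq_of_entire' 0 z hg, tsum_eq_sum (s := Finset.range (m + 1))]
  · simp [eval_finsetSum]
  · intro k hk
    rw [hzero k (by simpa using hk)]
    simp

/-- A nowhere vanishing entire function of finite order is the exponential of a polynomial. -/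
lemma HasExpPowGrowth.exists_eq_exp_polynomial {m : ℕ} {h : ℂ → ℂ} (hg : HasExpPowGrowth m h)
    (hh : Differentiable ℂ h) (h0 : ∀ z, h z ≠ 0) :
    ∃ G : ℂ[X], ∀ z, h z = Complex.exp (G.eval z) := by
  obtain ⟨g, hg0, hgd⟩ := (((hh.contDiff (n := 2)).differentiable_deriv_two.div hh
    h0).isExactOn_univ).with_val_at 0 (Complex.log (h 0))
  replace hgd (z : ℂ) : HasDerivAt g (deriv h z / h z) z := hgd z (mem_univ z)
  have hgdiff : Differentiable ℂ g := fun z => (hgd z).differentiableAt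
  have hexp (z : ℂ) : h z = Complex.exp (g z) := by
    have hd (y : ℂ) : HasDerivAt (fun y => h y * Complex.exp (-g y)) 0 y := by
      convert! (hh y).hasDerivAt.mul (hgd y).neg.cexp using 1
      field_simp [h0 y]
      ring
    have := is_const_of_deriv_eq_zero (fun y => (hd y).differentiableAt)
      (fun y => (hd y).deriv) z 0
    simp only [hg0, Complex.exp_neg, Complex.exp_log (h0 0), mul_inv_cancel₀ (h0 0)] at this
    field_simp at this
    exact this
  obtain ⟨C, hC⟩ := hg
  have hre (z : ℂ) : (g z).re ≤ C * (1 + ‖z‖) ^ m := by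
    simpa [hexp z, Complex.norm_exp] using hC z
  suffices hbound : ∀ z, ‖g z‖ ≤ (2 * ((|C| + 1) * 2 ^ m) + 3 * ‖g 0‖) * (1 + ‖z‖) ^ m by
    obtain ⟨G, hG⟩ := hgdiff.exists_polynomial_of_norm_le hbound
    exact ⟨G, fun z => by rw [hexp, hG]⟩
  intro z
  set r := 1 + ‖z‖ with hr
  have hr1 : 1 ≤ r := by linarith [norm_nonneg z]
  have hM : 0 < (|C| + 1) * (2 * r) ^ m := by positivity
  have hB := Complex.borelCaratheodory (R := 2 * r - 1) (z := z) hM hgdiff.differentiableOn ?_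
    (by linarith) (by rw [mem_ball_zero_iff]; linarith)
  · have hden : 2 * r - 1 - ‖z‖ = r := by rw [hr]; ring
    rw [hden] at hB
    have h1 : 2 * ((|C| + 1) * (2 * r) ^ m) * ‖z‖ / r ≤ 2 * ((|C| + 1) * (2 * r) ^ m) := by
      rw [div_le_iff₀ (by linarith)]
      gcongr
      linarith
    have h2 : ‖g 0‖ * (2 * r - 1 + ‖z‖) / r ≤ 3 * ‖g 0‖ * r ^ m := by
      rw [div_le_iff₀ (by linarith)]
      calc ‖g 0‖ * (2 * r - 1 + ‖z‖) ≤ ‖g 0‖ * (3 * r) := by gcongr; linarith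
        _ = 3 * ‖g 0‖ * 1 * r := by ring
        _ ≤ 3 * ‖g 0‖ * r ^ m * r := by gcongr; exact one_le_pow₀ hr1
    calc ‖g z‖ ≤ _ := hB
      _ ≤ 2 * ((|C| + 1) * (2 * r) ^ m) + 3 * ‖g 0‖ * r ^ m := add_le_add h1 h2
      _ = _ := by rw [mul_pow]; ring
  · intro y hy
    have hyR : ‖y‖ < 2 * r - 1 := by simpa using hy
    calc (g y).re ≤ C * (1 + ‖y‖) ^ m := hre y
      _ ≤ (|C| + 1) * (2 * r) ^ m := by
        gcongr
        · linarith [le_abs_self C]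
        · linarith

lemma degree_derivative_add_mul {Q G : ℂ[X]} (hQ : Q ≠ 0) (hG : G ≠ 0) :
    (derivative Q + Q * G).degree = Q.degree + G.degree := by
  rw [degree_add_eq_right_of_degree_lt, degree_mul]
  calc (derivative Q).degree < Q.degree := degree_derivative_lt hQ
    _ ≤ _ := degree_le_mul_left Q hG

/-- A nonzero entire solution of `ψ'' = P ψ`, with `P` a polynomial of odd degree, has infinitely
many zeros. -/
theorem infinite_zeros_of_deriv_deriv_eq_mul {ψ : ℂ → ℂ} {P : ℂ[X]} (hP : Odd P.natDegree)
    (hψ : Differentiable ℂ ψ) (hψ' : Differentiable ℂ (deriv ψ))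
    (hode : ∀ z, deriv (deriv ψ) z = P.eval z * ψ z) (hne : ∃ z, ψ z ≠ 0) :
    {z | ψ z = 0}.Infinite := by
  intro hfin
  obtain ⟨z₀, hz₀⟩ := hne
  obtain ⟨Q, h, hh, hhg, hh0, hQ⟩ := exists_eq_polynomial_mul_of_finite_zeros hfin hψ
    (hasExpPowGrowth_of_deriv_deriv_eq_mul hψ hψ' hode) rfl
    fun z hz hz' => hz₀ (eq_zero_of_deriv_deriv_eq_mul hψ hψ' P.continuous hode hz hz' z₀)
  obtain ⟨G, hG⟩ := hhg.exists_eq_exp_polynomial hh hh0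
  have hQ0 : Q ≠ 0 := by
    rintro rfl
    simp [hQ] at hz₀
  have hP0 : P ≠ 0 := by
    rintro rfl
    simp at hP
  have hderiv (R : ℂ[X]) : deriv (fun z => R.eval z * Complex.exp (G.eval z)) =
      fun z => (derivative R + R * derivative G).eval z * Complex.exp (G.eval z) := by
    funext z
    refine ((R.hasDerivAt z).mul (G.hasDerivAt z).cexp).deriv.trans ?_
    simp only [eval_add, eval_mul]
    ring
  have hψeq : ψ = fun z => Q.eval z * Complex.exp (G.eval z) := by
    funext z
    rw [hQ, hG]
  set L := derivative Q + Q * derivative G with hL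
  have hpoly : derivative L + L * derivative G = P * Q := by
    refine Polynomial.funext fun z => ?_
    have := hode z
    rw [hψeq, hderiv, hderiv, ← mul_assoc] at this
    simpa only [eval_mul] using mul_right_cancel₀ (Complex.exp_ne_zero _) this
  have hdeg := congrArg degree hpoly
  rw [degree_mul] at hdeg
  by_cases hG0 : derivative G = 0
  · have hlt : (P * Q).natDegree ≤ Q.natDegree := by
      rw [← hpoly, hL]
      simp only [hG0, mul_zero, add_zero]
      exact (natDegree_derivative_le _).trans
        ((Nat.sub_le _ _).trans ((natDegree_derivative_le _).trans (Nat.sub_le _ _)))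
    rw [natDegree_mul hP0 hQ0] at hlt
    have := hP.pos
    omega
  · have hL0 : L ≠ 0 := by
      rw [← degree_ne_bot, degree_derivative_add_mul hQ0 hG0, degree_eq_natDegree hQ0,
        degree_eq_natDegree hG0]
      exact WithBot.coe_ne_bot
    rw [degree_derivative_add_mul hL0 hG0, degree_derivative_add_mul hQ0 hG0,
      degree_eq_natDegree hQ0, degree_eq_natDegree hG0, degree_eq_natDegree hP0] at hdeg
    norm_cast at hdeg
    obtain ⟨k, hk⟩ := hP
    omega

end LinearODE

/-- Nevanlinna: let f = φ/χ be the ratio of two independent entire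
solutions of ψ'' = Pψ, P(λ) = 4λ³ - aλ - b, with asymptotic values w_k in the five
Stokes sectors (limits along the central rays of the sectors). Then every value
v ∈ ℂ∪{∞} that is not one of the asymptotic values w_0,…,w_4 is attained by f
infinitely often; in particular f has infinitely many poles (i.e. χ has infinitely
many zeros) whenever ∞ is not an asymptotic value. -/
theorem nevanlinna_omitted_values (a b : ℂ) (φ χ : ℂ → ℂ)
    (hφ : Differentiable ℂ φ) (hφ' : Differentiable ℂ (deriv φ))
    (hχ : Differentiable ℂ χ) (hχ' : Differentiable ℂ (deriv χ))
    (hodeφ : ∀ lam : ℂ, deriv (deriv φ) lam = (4 * lam ^ 3 - a * lam - b) * φ lam)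
    (hodeχ : ∀ lam : ℂ, deriv (deriv χ) lam = (4 * lam ^ 3 - a * lam - b) * χ lam)
    (hindep : ∀ c d : ℂ, (∀ lam : ℂ, c * φ lam + d * χ lam = 0) → c = 0 ∧ d = 0)
    (w : ZMod 5 → OnePoint ℂ)
    (hw : ∀ k : ZMod 5, Tendsto
      (fun x : ℝ => ratioToSphere φ χ (x * Complex.exp (Complex.I * (2 * Real.pi * (k.val : ℝ) / 5))))
      atTop (𝓝 (w k))) :
    (∀ v : OnePoint ℂ, v ∉ Set.range w → {lam : ℂ | ratioToSphere φ χ lam = v}.Infinite) ∧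
    ((∀ k : ZMod 5, w k ≠ ∞) → {lam : ℂ | χ lam = 0}.Infinite) := by
  set P : Polynomial ℂ :=
    Polynomial.C 4 * Polynomial.X ^ 3 - Polynomial.C a * Polynomial.X - Polynomial.C b with hPdef
  have hPeval (z : ℂ) : P.eval z = 4 * z ^ 3 - a * z - b := by simp [hPdef]
  have hPodd : Odd P.natDegree := by
    rw [show P.natDegree = 3 by rw [hPdef]; compute_degree!]
    decide
  simp only [← hPeval] at hodeφ hodeχ
  have hcomb (c d z : ℂ) : deriv (fun z => c * φ z + d * χ z) z = c * deriv φ z + d * deriv χ z :=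
    (((hφ z).hasDerivAt.const_mul c).add ((hχ z).hasDerivAt.const_mul d)).deriv
  have hcombdiff (c d : ℂ) : Differentiable ℂ (deriv fun z => c * φ z + d * χ z) := by
    rw [funext (hcomb c d)]
    fun_prop
  have hcombode (c d z : ℂ) : deriv (deriv fun z => c * φ z + d * χ z) z =
      P.eval z * (c * φ z + d * χ z) := by
    rw [funext (hcomb c d)]
    refine (((hφ' z).hasDerivAt.const_mul c).add ((hχ' z).hasDerivAt.const_mul d)).deriv.trans ?_
    rw [hodeφ, hodeχ]
    ring
  have hzeros (c d : ℂ) (hcd : ¬(c = 0 ∧ d = 0)) : {z | c * φ z + d * χ z = 0}.Infinite := by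
    refine infinite_zeros_of_deriv_deriv_eq_mul hPodd (by fun_prop) (hcombdiff c d)
      (hcombode c d) ?_
    by_contra! h
    exact hcd (hindep c d h)
  have hpoles : {z | χ z = 0}.Infinite := by simpa using hzeros 0 1 (by simp)
  have hcommon (z : ℂ) (hφz : φ z = 0) (hχz : χ z = 0) : False := by
    have h := hindep (deriv χ z) (-deriv φ z) (eq_zero_of_deriv_deriv_eq_mul (a := z) (by fun_prop)
      (hcombdiff _ _) P.continuous (hcombode _ _) (by simp [hφz, hχz])
      (by rw [hcomb]; ring))
    have hχ0 := eq_zero_of_deriv_deriv_eq_mul hχ hχ' P.continuous hodeχ hχz h.1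
    exact one_ne_zero (hindep 0 1 fun y => by simp [hχ0 y]).2
  refine ⟨fun v _ => ?_, fun _ => hpoles⟩
  induction v using OnePoint.rec with
  | infty => simpa [ratioToSphere] using hpoles
  | coe c =>
    refine (hzeros 1 (-c) (by simp)).mono fun z (hz : 1 * φ z + -c * χ z = 0) => ?_
    have hφz : φ z = c * χ z := by linear_combination hz
    have hχz : χ z ≠ 0 := fun h => hcommon z (by simp [hφz, h]) h
    simp [ratioToSphere, hφz, hχz]
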